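/- arXiv:2601.06850 — 4 statements merged into one kernel-verified Lean document; each statement's English description precedes it below -/
import Mathlib

section
/- Fix an integer k ≥ 1 and constants C > 0. Let (λ_i)_{i≥1} be strictly positive reals such that λ_i ≤ C·i·log i·log log i·…·log^{(k)} i for all sufficiently large i, where log^{(j)} is the j-fold iterated natural logarithm. Let (E_i)_{i≥1} be independent with E_i ~ Exp(λ_i). Then there exists t > 0 such that ∑_{n=1}^∞ P(∑_{i=1}^n E_i ≤ t) < ∞. -/
open MeasureTheory ProbabilityTheory Filter Finset

lemma aux_mgf {l θ : ℝ} (hl : 0 < l) (hθ : 0 < θ) :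
    mgf id (expMeasure l) (-θ) = l / (l + θ) := by
  have hlt : 0 < l + θ := by positivity
  rw [mgf, integral_eq_lintegral_of_nonneg_ae (Eventually.of_forall fun _ => (Real.exp_pos _).le)
    (by fun_prop)]
  have hm : Measurable (gammaPDF 1 l) := (measurable_gammaPDFReal 1 l).ennreal_ofReal
  rw [expMeasure, gammaMeasure, lintegral_withDensity_eq_lintegral_mul _ hm (by fun_prop)]
  have : ∀ x, (gammaPDF 1 l * fun x => ENNReal.ofReal (Real.exp (-θ * id x))) x
      = ENNReal.ofReal (l / (l + θ)) * exponentialPDF (l + θ) x := by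
    intro x
    change exponentialPDF l x * ENNReal.ofReal (Real.exp (-θ * id x)) = _
    rw [exponentialPDF_eq, exponentialPDF_eq]
    split_ifs with h
    · rw [← ENNReal.ofReal_mul (by positivity), ← ENNReal.ofReal_mul (by positivity)]
      congr 1
      rw [mul_assoc, ← Real.exp_add, ← mul_assoc, div_mul_cancel₀ _ hlt.ne']
      congr 2
      simp only [id]; ring
    · simp
  rw [lintegral_congr this, lintegral_const_mul' _ _ ENNReal.ofReal_ne_top,
    lintegral_exponentialPDF_eq_one hlt, mul_one, ENNReal.toReal_ofReal (by positivity)]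

lemma aux_chernoff {Ω : Type*} [MeasurableSpace Ω] (P : Measure Ω) [IsProbabilityMeasure P]
    (lam : ℕ → ℝ) (hlam : ∀ i ≥ 1, 0 < lam i)
    (E : ℕ → Ω → ℝ) (hmeas : ∀ i, Measurable (E i))
    (hindep : iIndepFun E P)
    (hdist : ∀ i ≥ 1, Measure.map (E i) P = expMeasure (lam i)) (N : ℕ) {θ : ℝ} (hθ : 0 < θ) :
    P.real {ω | ∑ i ∈ Finset.Icc 1 N, E i ω ≤ 1} ≤
      Real.exp (θ - θ * ∑ i ∈ Finset.Icc 1 N, 1 / (lam i + θ)) := by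
  have hm : ∀ i ∈ Finset.Icc 1 N, mgf (E i) P (-θ) = lam i / (lam i + θ) := by
    intro i hi
    have h1 := (Finset.mem_Icc.1 hi).1
    rw [← mgf_id_map (hmeas i).aemeasurable, hdist i h1, aux_mgf (hlam i h1) hθ]
  have hint : ∀ i ∈ Finset.Icc 1 N, Integrable (fun ω => Real.exp (-θ * E i ω)) P := by
    intro i hi
    have h1 := hlam i (Finset.mem_Icc.1 hi).1
    by_contra hc
    have h2 := hm i hi
    rw [mgf_undef hc] at h2
    have : 0 < lam i / (lam i + θ) := by positivity
    linarith
  have h := measure_le_le_exp_mul_mgf (μ := P) (X := ∑ i ∈ Finset.Icc 1 N, E i) (t := -θ) 1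
    (by linarith) (hindep.integrable_exp_mul_sum hmeas hint)
  rw [hindep.mgf_sum hmeas, Finset.prod_congr rfl hm] at h
  simp only [Finset.sum_apply] at h
  refine h.trans ?_
  rw [sub_eq_add_neg, Real.exp_add, neg_neg, mul_one, Finset.mul_sum, ← Finset.sum_neg_distrib,
    Real.exp_sum]
  gcongr with i hi
  · intro i hi
    have h1 := hlam i (Finset.mem_Icc.1 hi).1
    positivity
  · have h1 := hlam i (Finset.mem_Icc.1 hi).1
    have h2 := Real.add_one_le_exp (-(θ * (1 / (lam i + θ))))
    refine le_trans (le_of_eq ?_) h2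
    field_simp
    ring

lemma aux_tend (j : ℕ) : Tendsto (Real.log^[j]) atTop atTop := Real.tendsto_log_atTop.iterate j

lemma aux_incr (j : ℕ) : ∀ᶠ x : ℝ in atTop, ∀ δ : ℝ, 0 ≤ δ → δ ≤ 1 →
    Real.log^[j] x ≤ Real.log^[j] (x + δ) ∧
    Real.log^[j] (x + δ) - Real.log^[j] x ≤ 1 / ∏ l ∈ Finset.range j, Real.log^[l] x := by
  induction j with
  | zero =>
    refine Eventually.of_forall fun x δ h0 h1 => ?_
    simp
    constructor <;> linarith
  | succ j ih =>
    filter_upwards [ih, (aux_tend j).eventually_ge_atTop 1] with x hx hj δ h0 h1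
    obtain ⟨ha, hb⟩ := hx δ h0 h1
    rw [Function.iterate_succ_apply', Function.iterate_succ_apply', Finset.prod_range_succ]
    set a := Real.log^[j] x
    set b := Real.log^[j] (x + δ)
    have ha0 : 0 < a := by linarith
    have hb0 : 0 < b := by linarith
    refine ⟨Real.log_le_log ha0 ha, ?_⟩
    rw [← Real.log_div hb0.ne' ha0.ne']
    refine (Real.log_le_sub_one_of_pos (by positivity)).trans ?_
    rw [← div_div]
    have : b / a - 1 = (b - a) / a := by field_simp
    rw [this]
    gcongr

lemma aux_ge (k : ℕ) : ∀ᶠ x : ℝ in atTop, ∀ j ∈ Finset.range k, 1 ≤ Real.log^[j] x := by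
  rw [Filter.eventually_all_finset]
  intro j _
  exact (aux_tend j).eventually_ge_atTop 1

lemma aux_one_le_prod {s : Finset ℕ} {f : ℕ → ℝ} (h : ∀ i ∈ s, 1 ≤ f i) :
    1 ≤ ∏ i ∈ s, f i := by
  have := Finset.prod_le_prod (s := s) (f := fun _ => (1:ℝ)) (g := f) (fun _ _ => zero_le_one) h
  simpa using this

lemma aux_prod (k : ℕ) (x : ℝ) : ∏ l ∈ Finset.range (k+1), Real.log^[l] x
    = x * ∏ j ∈ Finset.Icc 1 k, Real.log^[j] x := by
  rw [Finset.prod_range_succ', mul_comm]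
  congr 1
  rw [← Finset.Ico_succ_right_eq_Icc, Finset.prod_Ico_eq_prod_range]
  simp [add_comm]

lemma aux_analytic (k : ℕ) (C : ℝ) (hC : 0 < C)
    (lam : ℕ → ℝ) (hlam : ∀ i ≥ 1, 0 < lam i)
    (hdom : ∀ᶠ i : ℕ in atTop,
      lam i ≤ C * i * ∏ j ∈ Finset.Icc 1 k, Real.log^[j] i) :
    ∀ᶠ N : ℕ in atTop, 3 ≤ ∑ i ∈ Finset.Icc 1 N, 1 / (lam i + Real.log N) := by
  have hcast := tendsto_natCast_atTop_atTop (R := ℝ)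
  obtain ⟨I, hI⟩ := eventually_atTop.1 (((hdom.and (hcast.eventually (aux_incr (k+1)))).and
    (hcast.eventually (aux_ge (k+1)))))
  have hlogN := Real.tendsto_log_atTop.comp hcast
  have hceil := tendsto_nat_ceil_atTop.comp hlogN
  have hy := (aux_tend (k+1)).comp hcast
  have hyl : ∀ᶠ y : ℝ in atTop, 3 * (C + 1) + 1 ≤ y - Real.log y := by
    have h1 := Real.isLittleO_log_id_atTop.def (c := 1/2) (by norm_num)
    filter_upwards [h1, eventually_ge_atTop (2 * (3 * (C+1) + 1))] with y h1 h2
    simp only [id, Real.norm_eq_abs] at h1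
    rw [abs_of_nonneg (a := y) (by linarith)] at h1
    linarith [le_abs_self (Real.log y)]
  filter_upwards [hceil.eventually_ge_atTop (max I 1), hy.eventually hyl,
    hlogN.eventually (aux_incr (k+1)), hlogN.eventually (aux_ge (k+1)), hlogN.eventually_ge_atTop 1]
    with N hm hyN hinc hge hl1
  simp only [Function.comp] at *
  set m := ⌈Real.log N⌉₊ with hmdef
  have hmI : I ≤ m := le_trans (le_max_left _ _) hm
  have hm1 : 1 ≤ m := le_trans (le_max_right _ _) hm
  have hmN : m ≤ N := Nat.ceil_le.2 (Real.log_le_self (by positivity))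
  have hlm : Real.log N ≤ m := Nat.le_ceil _
  have hlm' : (m : ℝ) < Real.log N + 1 := Nat.ceil_lt_add_one (by linarith)
  -- bound on f m
  have hfm : Real.log^[k+1] (m:ℝ) ≤ Real.log (Real.log^[k+1] (N:ℝ)) + 1 := by
    have h := (hinc (m - Real.log N) (by linarith) (by linarith)).2
    have hp : 1 ≤ ∏ l ∈ Finset.range (k+1), Real.log^[l] (Real.log N) :=
      aux_one_le_prod hge
    have hp' := (div_le_one (by linarith)).2 hp
    rw [add_sub_cancel] at h
    have e : Real.log (Real.log^[k+1] (N:ℝ)) = Real.log^[k+1] (Real.log N) := by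
      rw [← Function.iterate_succ_apply' Real.log, Function.iterate_succ_apply]
    rw [e]
    linarith
  have hsub : ∑ i ∈ Finset.Ico m N, 1 / (lam i + Real.log N) ≤
      ∑ i ∈ Finset.Icc 1 N, 1 / (lam i + Real.log N) := by
    apply Finset.sum_le_sum_of_subset_of_nonneg
    · intro i hi
      simp only [Finset.mem_Ico, Finset.mem_Icc] at *
      omega
    · intro i hi _
      have := hlam i (Finset.mem_Icc.1 hi).1
      positivity
  have hterm : ∀ i ∈ Finset.Ico m N,
      (Real.log^[k+1] ((i+1 : ℕ) : ℝ) - Real.log^[k+1] (i : ℝ)) / (C+1) ≤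
        1 / (lam i + Real.log N) := by
    intro i hi
    have him := (Finset.mem_Ico.1 hi).1
    obtain ⟨⟨h1, h2⟩, h3⟩ := hI i (hmI.trans him)
    have h4 := (h2 1 zero_le_one le_rfl).2
    rw [aux_prod] at h4
    have hi1 : (1:ℝ) ≤ i := by exact_mod_cast hm1.trans him
    have hp : 1 ≤ ∏ j ∈ Finset.Icc 1 k, Real.log^[j] (i:ℝ) := by
      apply aux_one_le_prod
      intro j hj
      apply h3
      simp at hj ⊢; omega
    set L := ∏ j ∈ Finset.Icc 1 k, Real.log^[j] (i:ℝ)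
    have hli := hlam i (hm1.trans him)
    have hmi : (m:ℝ) ≤ i := by exact_mod_cast him
    push_cast
    calc _ ≤ (1 / (i * L)) / (C+1) := by gcongr
      _ = 1 / (i * L * (C+1)) := by rw [div_div]
      _ ≤ _ := by
        apply one_div_le_one_div_of_le (by linarith)
        nlinarith
  have hsum := Finset.sum_le_sum hterm
  rw [← Finset.sum_div, Finset.sum_Ico_sub (fun i : ℕ => Real.log^[k+1] (i:ℝ)) hmN] at hsum
  refine le_trans ?_ (hsum.trans hsub)
  rw [le_div_iff₀ (by linarith)]
  linarith

/-- Remark 2 consequence: if `λ_i ≤ C · i · log i · log log i ⋯ log^{(k)} i` for all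
large `i`, and `E_i ~ Exp(λ_i)` are independent, then there is `t > 0` with
`∑_n P(∑_{i=1}^n E_i ≤ t) < ∞`. -/
theorem stmt_6
    {Ω : Type*} [MeasurableSpace Ω] (P : Measure Ω) [IsProbabilityMeasure P]
    (k : ℕ) (hk : 1 ≤ k) (C : ℝ) (hC : 0 < C)
    (lam : ℕ → ℝ) (hlam : ∀ i ≥ 1, 0 < lam i)
    (hdom : ∀ᶠ i : ℕ in atTop,
      lam i ≤ C * i * ∏ j ∈ Finset.Icc 1 k, Real.log^[j] i)
    (E : ℕ → Ω → ℝ) (hmeas : ∀ i, Measurable (E i))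
    (hindep : iIndepFun E P)
    (hdist : ∀ i ≥ 1, Measure.map (E i) P = expMeasure (lam i)) :
    ∃ t > (0 : ℝ),
      ∑' n : ℕ, P {ω | ∑ i ∈ Finset.Icc 1 (n + 1), E i ω ≤ t} < ⊤ := by
  refine ⟨1, one_pos, ?_⟩
  have key : ∀ᶠ N : ℕ in atTop, P.real {ω | ∑ i ∈ Finset.Icc 1 N, E i ω ≤ 1} ≤
      1 / (N:ℝ)^2 := by
    filter_upwards [aux_analytic k C hC lam hlam hdom, eventually_ge_atTop 2] with N hN h2
    have hN1 : (1:ℝ) < N := by exact_mod_cast h2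
    have hl : 0 < Real.log N := Real.log_pos hN1
    refine (aux_chernoff P lam hlam E hmeas hindep hdist N hl).trans ?_
    have : 1 / (N:ℝ)^2 = Real.exp (-(2 * Real.log N)) := by
      rw [Real.exp_neg, two_mul, Real.exp_add, Real.exp_log (by linarith), one_div, sq]
    rw [this]
    apply Real.exp_le_exp.2
    nlinarith
  have hs : Summable fun N : ℕ => P.real {ω | ∑ i ∈ Finset.Icc 1 N, E i ω ≤ 1} := by
    refine Summable.of_norm_bounded_eventually_nat
      (Real.summable_one_div_nat_pow.2 one_lt_two) ?_
    filter_upwards [key] with N hN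
    rwa [Real.norm_of_nonneg measureReal_nonneg]
  have hs1 := (summable_nat_add_iff 1).2 hs
  have h := hs1.tsum_ofReal_lt_top
  simpa [ofReal_measureReal] using h
end

section
/- For k ≥ 1 set d_k = 4^{k²} and α_k = 2^{2^{k³}}, and set M_i = i + ∑_{k=1}^i d_k for i ≥ 0 (with M_0 = 0). Define the rate sequence (λ_j)_{j≥1} by: λ_j = 1 if j = M_{k−1} + 1 for some k ≥ 1, and λ_j = α_k if M_{k−1} + 2 ≤ j ≤ M_k (i.e., the sequence 1, α_1 repeated d_1 times, 1, α_2 repeated d_2 times, 1, …). Let (E_j)_{j≥1} be independent with E_j ~ Exp(λ_j). Then (a) ∑_{j=1}^∞ λ_j^{-1} = ∞, and (b) lim_{i→∞} (M_i/i)·P( ∑_{j=1}^{M_{i+1}+1} E_j ≤ 2^{-i} ) = ∞. -/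
open MeasureTheory ProbabilityTheory Filter Finset

lemma h9_exp {Ω : Type*} [MeasurableSpace Ω] (P : Measure Ω) [IsProbabilityMeasure P]
    (X : Ω → ℝ) (hX : Measurable X) (r t : ℝ) (hr : 0 < r) (ht : 0 < t)
    (hd : Measure.map X P = expMeasure r) :
    Real.exp (-Real.log (1 + 1 / (r * t))) ≤ (P (X ⁻¹' Set.Iic t)).toReal := by
  rw [← Measure.map_apply hX measurableSet_Iic, hd]
  have h := cdf_expMeasure_eq hr t
  have := isProbabilityMeasure_expMeasure hr
  rw [cdf_eq_real, if_pos ht.le] at h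
  change _ ≤ (expMeasure r).real _
  rw [h, Real.exp_neg, Real.exp_log (by positivity)]
  have hx : 0 < r * t := by positivity
  have h1 := Real.add_one_le_exp (r * t)
  rw [Real.exp_neg]
  have h2 : (Real.exp (r*t))⁻¹ ≤ (r*t+1)⁻¹ := inv_anti₀ (by positivity) h1
  have h3 : (1 + 1/(r*t))⁻¹ = 1 - (r*t+1)⁻¹ := by field_simp; ring
  linarith

lemma h9_prob {Ω : Type*} [MeasurableSpace Ω] (P : Measure Ω) [IsProbabilityMeasure P]
    (E : ℕ → Ω → ℝ) (hmeas : ∀ j, Measurable (E j)) (hindep : iIndepFun E P)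
    (lam t : ℕ → ℝ) (S : Finset ℕ) (hl : ∀ j ∈ S, 0 < lam j) (ht : ∀ j ∈ S, 0 < t j)
    (hdist : ∀ j ∈ S, Measure.map (E j) P = expMeasure (lam j)) (e : ℝ)
    (he : ∑ j ∈ S, t j ≤ e) :
    Real.exp (-∑ j ∈ S, Real.log (1 + 1 / (lam j * t j))) ≤
      (P {ω | ∑ j ∈ S, E j ω ≤ e}).toReal := by
  have h1 := hindep.measure_inter_preimage_eq_mul S (sets := fun j => Set.Iic (t j))
    (fun j _ => measurableSet_Iic)
  have h2 : (P (⋂ j ∈ S, E j ⁻¹' Set.Iic (t j))).toReal ≤ (P {ω | ∑ j ∈ S, E j ω ≤ e}).toReal := by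
    apply ENNReal.toReal_mono (measure_ne_top _ _)
    apply measure_mono
    intro ω hω
    simp only [Set.mem_iInter, Set.mem_preimage, Set.mem_Iic] at hω
    exact (Finset.sum_le_sum hω).trans he
  refine le_trans ?_ h2
  rw [h1, ENNReal.toReal_prod, ← Finset.sum_neg_distrib, Real.exp_sum]
  apply Finset.prod_le_prod
  · intros; positivity
  · intro j hj
    exact h9_exp P (E j) (hmeas j) _ _ (hl j hj) (ht j hj) (hdist j hj)

lemma h9_succ (d M : ℕ → ℕ) (hM : ∀ i, M i = i + ∑ k ∈ Finset.Icc 1 i, d k) (n : ℕ) :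
    M (n+1) = M n + 1 + d (n+1) := by
  rw [hM, hM, Finset.sum_Icc_succ_top (by omega)]; ring

lemma h9_sum (d M : ℕ → ℕ) (hM : ∀ i, M i = i + ∑ k ∈ Finset.Icc 1 i, d k)
    (f : ℕ → ℝ) (a : ℝ) (b : ℕ → ℝ) (h1 : ∀ k, f (M k + 1) = a)
    (h2 : ∀ k ≥ 1, ∀ j, M (k - 1) + 2 ≤ j → j ≤ M k → f j = b k) (n : ℕ) :
    ∑ j ∈ Finset.Icc 1 (M n + 1), f j = (n + 1) * a + ∑ k ∈ Finset.Icc 1 n, d k * b k := by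
  induction n with
  | zero =>
    have := h1 0
    have h0 : M 0 = 0 := by simp [hM]
    rw [h0] at this ⊢
    simpa using this
  | succ n ih =>
    have key : ∀ m ≤ d (n+1), ∑ j ∈ Finset.Icc 1 (M n + 1 + m), f j
        = ∑ j ∈ Finset.Icc 1 (M n + 1), f j + m * b (n+1) := by
      intro m
      induction m with
      | zero => simp
      | succ m ihm =>
        intro hm
        rw [← add_assoc, Finset.sum_Icc_succ_top (by omega), ihm (by omega),
          h2 (n+1) (by omega) _ (by simp) (by rw [h9_succ d M hM]; omega)]
        push_cast; ring
    rw [Finset.sum_Icc_succ_top (by omega), h1, h9_succ d M hM, key _ le_rfl, ih,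
      Finset.sum_Icc_succ_top (by omega)]
    push_cast; ring

lemma h9_mono (d M : ℕ → ℕ) (hM : ∀ i, M i = i + ∑ k ∈ Finset.Icc 1 i, d k) : StrictMono M :=
  strictMono_nat_of_lt_succ fun n => by rw [h9_succ d M hM]; omega

lemma h9_class (d M : ℕ → ℕ) (hM : ∀ i, M i = i + ∑ k ∈ Finset.Icc 1 i, d k) (j : ℕ) (hj : 1 ≤ j) :
    (∃ k, j = M k + 1) ∨ ∃ k ≥ 1, M (k-1) + 2 ≤ j ∧ j ≤ M k := by
  have hex : ∃ k, j ≤ M k + 1 := ⟨j, by rw [hM]; omega⟩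
  classical
  have h1 := Nat.find_spec hex
  set k := Nat.find hex with hk
  by_cases h : j = M k + 1
  · exact Or.inl ⟨k, h⟩
  · right
    have h0 : M 0 = 0 := by simp [hM]
    have hk1 : 1 ≤ k := by
      by_contra hc
      have : k = 0 := by omega
      rw [this] at h h1; omega
    have := Nat.find_min hex (m := k - 1) (by omega)
    exact ⟨k, hk1, by omega, by omega⟩

lemma h9_ext (d M : ℕ → ℕ) (hM : ∀ i, M i = i + ∑ k ∈ Finset.Icc 1 i, d k) (a : ℝ) (b : ℕ → ℝ) :
    ∃ t : ℕ → ℝ, (∀ k, t (M k + 1) = a) ∧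
      (∀ k ≥ 1, ∀ j, M (k - 1) + 2 ≤ j → j ≤ M k → t j = b k) := by
  classical
  have hmono := h9_mono d M hM
  have hex : ∀ j, ∃ k, j ≤ M k + 1 := fun j => ⟨j, by rw [hM]; omega⟩
  refine ⟨fun j => if j = M (Nat.find (hex j)) + 1 then a else b (Nat.find (hex j)), ?_, ?_⟩
  · intro k
    have : Nat.find (hex (M k + 1)) = k := by
      rw [Nat.find_eq_iff]
      refine ⟨le_rfl, fun n hn => ?_⟩
      have := hmono hn; omega
    simp only [this, if_true]
  · intro k hk j h1 h2
    have : Nat.find (hex j) = k := by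
      rw [Nat.find_eq_iff]
      refine ⟨by omega, fun n hn => ?_⟩
      have := hmono.monotone (show n ≤ k - 1 by omega); omega
    simp only [this]
    rw [if_neg (by omega)]

lemma h9_final (F : ℕ → ℝ) (C : ℝ) (h : ∀ i : ℕ, 1 ≤ i →
    Real.exp (Real.log 2 * (√i) ^ 4 - C * (√i) ^ 3) ≤ F i) : Tendsto F atTop atTop := by
  have hs : Tendsto (fun i : ℕ => √(i:ℝ)) atTop atTop :=
    Real.tendsto_sqrt_atTop.comp tendsto_natCast_atTop_atTop
  have h3 : Tendsto (fun s : ℝ => s ^ 3 * (Real.log 2 * s + (-C))) atTop atTop := by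
    apply Tendsto.atTop_mul_atTop₀ (tendsto_pow_atTop (by norm_num))
    apply tendsto_atTop_add_const_right
    exact tendsto_id.const_mul_atTop (Real.log_pos (by norm_num))
  refine tendsto_atTop_mono' _ ?_ (Real.tendsto_exp_atTop.comp (h3.comp hs))
  filter_upwards [eventually_ge_atTop 1] with i hi
  refine le_trans (le_of_eq ?_) (h i hi)
  simp only [Function.comp]
  congr 1; ring

/-- large block -/
lemma h9_pow1 (k : ℕ) (hk : 1 ≤ k) : 4 * k ^ 2 ≤ 2 ^ (k ^ 3 - 1) + 3 := by
  rcases Nat.lt_or_ge k 2 with h | h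
  · interval_cases k; norm_num
  have : k^3 - 1 ≥ 3 * k + 1 := by
    have : k ^ 3 = k * k * k := by ring
    have : 4 * k ≤ k * k * k := by nlinarith
    omega
  have h2 : 2 ^ (3*k+1) ≤ 2 ^ (k^3-1) := Nat.pow_le_pow_right (by norm_num) this
  have h3 : k < 2 ^ k := Nat.lt_two_pow_self
  have : 2 ^ (3*k+1) = 2 * (2^k*2^k*2^k) := by ring
  have h4 : 2^2 ≤ 2 ^ k := Nat.pow_le_pow_right (by norm_num) h
  have h5 : k^2 ≤ 2^k * 2^k := by nlinarith
  nlinarith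

lemma h9_pow2 (k : ℕ) : 4 * k ^ 2 + 2 * k ≤ k ^ 3 + 16 := by
  rcases Nat.lt_or_ge k 5 with h | h
  · interval_cases k <;> norm_num
  obtain ⟨m, rfl⟩ := Nat.exists_eq_add_of_le h
  nlinarith [sq_nonneg m, Nat.zero_le (m^3)]

lemma h9_pow3 (k : ℕ) (hk : 1 ≤ k) : 2 * k ^ 2 ≤ 2 ^ (k ^ 3) := by
  rcases Nat.lt_or_ge k 2 with h | h
  · interval_cases k; norm_num
  have := h9_pow1 k hk
  have h2 : 2 ^ (k^3) = 2 * 2 ^ (k^3-1) := by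
    rw [← pow_succ']; congr 1
    have : 1 ≤ k^3 := Nat.one_le_pow _ _ (by omega)
    omega
  nlinarith

lemma h9_block (i k : ℕ) (hk : 1 ≤ k) :
    ((4:ℝ) ^ (k^2)) * Real.log (1 + 2^i * 2 * (i+1) * 4 ^ (k^2) / 2 ^ (2 ^ (k^3))) ≤
      16 + 512 * (i+1) * √(8 * i) * (1/2)^k := by
  have hi2 : ((i:ℝ)+1) ≤ 2^i := by
    have : i + 1 ≤ 2 ^ i := Nat.lt_two_pow_self
    exact_mod_cast this
  have hD : (4:ℝ)^(k^2) = 2 ^ (2*k^2) := by rw [pow_mul]; norm_num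
  have hk3 : 2 ^ (k^3) = 2 * 2 ^ (k^3-1) := by
    rw [← pow_succ']; congr 1
    have : 1 ≤ k^3 := Nat.one_le_pow _ _ (by omega)
    omega
  rcases le_or_gt (8 * i) (2 ^ (k^3)) with h | h
  · have h1 : Real.log (1 + 2^i * 2 * (i+1) * 4 ^ (k^2) / 2 ^ (2 ^ (k^3))) ≤
        2^i * 2 * (i+1) * 4 ^ (k^2) / 2 ^ (2 ^ (k^3)) := by
      have := Real.log_le_sub_one_of_pos
        (show (0:ℝ) < 1 + 2^i * 2 * (i+1) * 4 ^ (k^2) / 2 ^ (2 ^ (k^3)) by positivity)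
      linarith
    have h2 : (0:ℝ) ≤ 512 * (i+1) * √(8 * i) * (1/2)^k := by positivity
    have h3 : (4:ℝ)^(k^2) * (2^i * 2 * (i+1) * 4 ^ (k^2) / 2 ^ (2 ^ (k^3))) ≤ 16 := by
      rw [← mul_div_assoc, div_le_iff₀ (by positivity), hD]
      calc (2:ℝ)^(2*k^2) * (2^i * 2 * (i+1) * 2 ^ (2*k^2))
          ≤ (2:ℝ)^(2*k^2) * (2^i * 2 * 2^i * 2 ^ (2*k^2)) := by gcongr
        _ = 2 ^ (2*k^2 + (i + 1 + i + 2*k^2)) := by simp only [pow_add, pow_one]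
        _ ≤ 2 ^ (4 + 2 ^ (k^3)) := by
          apply pow_le_pow_right₀ (by norm_num)
          have := h9_pow1 k hk
          omega
        _ = 16 * 2 ^ (2^(k^3)) := by rw [pow_add]; norm_num
    have h4 := mul_le_mul_of_nonneg_left h1 (show (0:ℝ) ≤ 4^(k^2) by positivity)
    linarith
  · have h1 : (4:ℝ)^(k^2) * 2^k ≤ 256 * √(8 * i) := by
      apply abs_le_of_sq_le_sq' _ (by positivity) |>.2
      rw [mul_pow, mul_pow, Real.sq_sqrt (by positivity), hD, ← pow_mul, ← pow_mul, ← pow_add]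
      calc (2:ℝ)^(2*k^2*2 + k*2) ≤ 2 ^ (16 + k^3) := by
            apply pow_le_pow_right₀ (by norm_num)
            have := h9_pow2 k
            omega
        _ = 256^2 * 2^(k^3) := by rw [pow_add]; norm_num
        _ ≤ 256^2 * (8 * i) := by
            gcongr
            exact_mod_cast h.le
    have h1' : (4:ℝ)^(k^2) ≤ 256 * √(8 * i) * (1/2)^k := by
      rw [one_div, inv_pow, ← div_eq_mul_inv, le_div_iff₀ (by positivity)]; exact h1
    have h2 : Real.log (1 + 2^i * 2 * (i+1) * 4 ^ (k^2) / 2 ^ (2 ^ (k^3))) ≤ 2 * (i+1) := by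
      rw [Real.log_le_iff_le_exp (by positivity)]
      have ha : (2:ℝ)^i * 2 * (i+1) * 4 ^ (k^2) / 2 ^ (2 ^ (k^3)) ≤ 2^i * 2 * (i+1) := by
        rw [div_le_iff₀ (by positivity), hD]
        gcongr
        · norm_num
        · exact h9_pow3 k hk
      have hb : (4:ℝ)^(i+1) ≤ Real.exp (2 * (i+1)) := by
        have : Real.exp (2 * (i+1)) = (Real.exp 1 ^ 2) ^ (i+1) := by
          rw [← pow_mul, ← Real.exp_nat_mul]; push_cast; ring_nf
        rw [this]
        gcongr
        have := Real.add_one_le_exp (1:ℝ)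
        nlinarith
      have hc : (4:ℝ)^i = 2^i * 2^i := by rw [← mul_pow]; norm_num
      have hd : (1:ℝ) ≤ 2^i := one_le_pow₀ (by norm_num)
      rw [pow_succ] at hb
      nlinarith
    calc _ ≤ (256 * √(8 * i) * (1/2)^k) * (2 * ((i:ℝ)+1)) := by
          apply mul_le_mul h1' h2 _ (by positivity)
          apply Real.log_nonneg
          have : (0:ℝ) ≤ 2^i * 2 * (i+1) * 4 ^ (k^2) / 2 ^ (2 ^ (k^3)) := by positivity
          linarith
      _ ≤ _ := by linarith

lemma h9_geom (n : ℕ) : ∑ k ∈ Finset.Icc 1 n, ((1:ℝ)/2)^k = 1 - (1/2)^n := by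
  induction n with
  | zero => simp
  | succ n ih => rw [Finset.sum_Icc_succ_top (by omega), ih]; ring

lemma h9_blocks (i : ℕ) : ∑ k ∈ Finset.Icc 1 (i+1),
    ((4:ℝ) ^ (k^2)) * Real.log (1 + 2^i * 2 * (i+1) * 4 ^ (k^2) / 2 ^ (2 ^ (k^3))) ≤
      16 * (i+1) + 512 * (i+1) * √(8 * i) := by
  refine (Finset.sum_le_sum fun k hk => h9_block i k (Finset.mem_Icc.1 hk).1).trans ?_
  rw [Finset.sum_add_distrib, ← Finset.mul_sum, h9_geom]
  have : (0:ℝ) ≤ 512 * (i+1) * √(8 * i) * (1/2)^(i+1) := by positivity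
  simp only [Finset.sum_const, Nat.card_Icc, nsmul_eq_mul, Nat.add_sub_cancel]
  push_cast
  linarith

lemma h9_log_le (x : ℝ) (hx : 0 < x) : Real.log x ≤ 2 * √x := by
  have h := Real.log_le_sub_one_of_pos (Real.sqrt_pos.2 hx)
  rw [Real.log_sqrt hx.le] at h
  linarith

lemma h9_total (i : ℕ) (hi : 1 ≤ i) :
    ((i:ℝ)+2) * Real.log (1 + 2^i * 2 * (i+2)) + (16 * (i+1) + 512 * (i+1) * √(8 * i))
     + Real.log i ≤ Real.log 2 * (√i)^4 + 4000 * (√i)^3 := by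
  have hi' : (1:ℝ) ≤ i := by exact_mod_cast hi
  set s := √(i:ℝ) with hs
  have hs1 : 1 ≤ s := Real.one_le_sqrt.2 hi'
  have hsi : (i:ℝ) = s^2 := (Real.sq_sqrt (by positivity)).symm
  have h8 : √(8 * (i:ℝ)) ≤ 3 * s := by
    apply Real.sqrt_le_iff.2 ⟨by positivity, by nlinarith⟩
  have hlog : Real.log i ≤ 2 * s := h9_log_le _ (by positivity)
  have h1 : Real.log (1 + 2^i * 2 * (i+2)) ≤ i * Real.log 2 + 6 * s := by
    have ha : (1:ℝ) + 2^i * 2 * (i+2) ≤ 2^i * (7 * i) := by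
      have : (1:ℝ) ≤ 2^i := one_le_pow₀ (by norm_num)
      have hq : (i:ℝ) + 1 ≤ 2 ^ i := by
        have : i + 1 ≤ 2 ^ i := Nat.lt_two_pow_self
        exact_mod_cast this
      nlinarith
    refine (Real.log_le_log (by positivity) ha).trans ?_
    rw [Real.log_mul (by positivity) (by positivity), Real.log_pow]
    have := h9_log_le (7 * i) (by positivity)
    have h7 : √(7 * (i:ℝ)) ≤ 3 * s := by
      apply Real.sqrt_le_iff.2 ⟨by positivity, by nlinarith⟩
    linarith
  have hl2 : Real.log 2 ≤ 1 := by
    have := Real.log_two_lt_d9; linarith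
  have hl0 : 0 ≤ Real.log 2 := Real.log_nonneg (by norm_num)
  have hs2 : s ≤ s^2 := by nlinarith
  have hs3 : s^2 ≤ s^3 := by nlinarith
  have e1 : ((i:ℝ)+2) * Real.log (1 + 2^i * 2 * (i+2)) ≤ (i+2) * (i * Real.log 2 + 6 * s) := by
    gcongr
  have e2 : 512 * ((i:ℝ)+1) * √(8 * i) ≤ 512 * (i+1) * (3*s) := by gcongr
  rw [hsi] at *
  have e3 : 2 * s^2 * Real.log 2 ≤ 2 * s^2 := by nlinarith
  nlinarith

theorem stmt_9
    {Ω : Type*} [MeasurableSpace Ω] (P : Measure Ω) [IsProbabilityMeasure P]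
    (d : ℕ → ℕ) (hd : ∀ k, d k = 4 ^ (k ^ 2))
    (α : ℕ → ℝ) (hα : ∀ k, α k = 2 ^ (2 ^ (k ^ 3)))
    (M : ℕ → ℕ) (hM : ∀ i, M i = i + ∑ k ∈ Finset.Icc 1 i, d k)
    (lam : ℕ → ℝ)
    (hlam1 : ∀ k : ℕ, lam (M k + 1) = 1)
    (hlam2 : ∀ k ≥ 1, ∀ j, M (k - 1) + 2 ≤ j → j ≤ M k → lam j = α k)
    (E : ℕ → Ω → ℝ) (hmeas : ∀ j, Measurable (E j))
    (hindep : iIndepFun E P)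
    (hdist : ∀ j ≥ 1, Measure.map (E j) P = expMeasure (lam j)) :
    Tendsto (fun n : ℕ => ∑ j ∈ Finset.Icc 1 n, (lam j)⁻¹) atTop atTop ∧
    Tendsto (fun i : ℕ => (M i : ℝ) / i *
        (P {ω | ∑ j ∈ Finset.Icc 1 (M (i + 1) + 1), E j ω ≤ 2 ^ (-(i : ℝ))}).toReal)
      atTop atTop := by
  have hpos : ∀ j ≥ 1, 0 < lam j := by
    intro j hj
    rcases h9_class d M hM j hj with ⟨k, rfl⟩ | ⟨k, hk, h1, h2⟩
    · rw [hlam1]; norm_num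
    · rw [hlam2 k hk j h1 h2, hα]; positivity
  constructor
  · apply tendsto_atTop_atTop_of_monotone
    · intro m n hmn
      apply Finset.sum_le_sum_of_subset_of_nonneg (Finset.Icc_subset_Icc_right hmn)
      intro j hj _
      exact (inv_pos.2 (hpos j (Finset.mem_Icc.1 hj).1)).le
    · intro b
      obtain ⟨n, hn⟩ := exists_nat_ge b
      refine ⟨M n + 1, ?_⟩
      rw [h9_sum d M hM (fun j => (lam j)⁻¹) 1 (fun k => (α k)⁻¹) (fun k => by simp [hlam1])
        (fun k hk j h1 h2 => by simp [hlam2 k hk j h1 h2])]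
      have : 0 ≤ ∑ k ∈ Finset.Icc 1 n, (d k : ℝ) * (α k)⁻¹ :=
        Finset.sum_nonneg fun k _ => by rw [hα]; positivity
      linarith
  · apply h9_final _ 4000
    intro i hi
    have hi' : (1:ℝ) ≤ i := by exact_mod_cast hi
    obtain ⟨t, ht1, ht2⟩ := h9_ext d M hM (1 / (2^i * 2 * ((i:ℝ)+2)))
      (fun k => 1 / (2^i * 2 * ((i:ℝ)+1) * 4^(k^2)))
    have htpos : ∀ j ≥ 1, 0 < t j := by
      intro j hj
      rcases h9_class d M hM j hj with ⟨k, rfl⟩ | ⟨k, hk, h1, h2⟩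
      · rw [ht1]; positivity
      · rw [ht2 k hk j h1 h2]; positivity
    have hsum : ∑ j ∈ Finset.Icc 1 (M (i + 1) + 1), t j ≤ 2 ^ (-(i : ℝ)) := by
      rw [h9_sum d M hM t _ _ ht1 ht2, Real.rpow_neg (by norm_num), Real.rpow_natCast]
      have : ∀ k ∈ Finset.Icc 1 (i+1), (d k : ℝ) * (1 / (2^i * 2 * ((i:ℝ)+1) * 4^(k^2))) =
          1 / (2^i * 2 * ((i:ℝ)+1)) := by
        intro k _
        rw [hd]; push_cast; field_simp
      rw [Finset.sum_congr rfl this]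
      simp only [Finset.sum_const, Nat.card_Icc, nsmul_eq_mul]
      apply le_of_eq
      push_cast [Nat.add_sub_cancel]
      field_simp
      ring
    have hP := h9_prob P E hmeas hindep lam t (Finset.Icc 1 (M (i + 1) + 1))
      (fun j hj => hpos j (Finset.mem_Icc.1 hj).1) (fun j hj => htpos j (Finset.mem_Icc.1 hj).1)
      (fun j hj => hdist j (Finset.mem_Icc.1 hj).1) _ hsum
    have hS : ∑ j ∈ Finset.Icc 1 (M (i + 1) + 1), Real.log (1 + 1 / (lam j * t j)) ≤
        ((i:ℝ)+2) * Real.log (1 + 2^i * 2 * (i+2)) + (16 * (i+1) + 512 * (i+1) * √(8 * i)) := by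
      rw [h9_sum d M hM (fun j => Real.log (1 + 1 / (lam j * t j)))
        (Real.log (1 + 2^i * 2 * (i+2)))
        (fun k => Real.log (1 + 2^i * 2 * (i+1) * 4 ^ (k^2) / 2 ^ (2 ^ (k^3))))
        (fun k => by simp [hlam1, ht1])
        (fun k hk j h1 h2 => by
          rw [hlam2 k hk j h1 h2, ht2 k hk j h1 h2, hα]
          congr 2
          field_simp)]
      have := h9_blocks i
      simp only [hd]
      push_cast
      linarith
    have hMi : (4:ℝ)^(i^2) ≤ M i := by
      have h1 : d i ≤ ∑ k ∈ Finset.Icc 1 i, d k :=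
        Finset.single_le_sum (f := d) (fun _ _ => Nat.zero_le _) (Finset.mem_Icc.2 ⟨hi, le_rfl⟩)
      have : 4^(i^2) ≤ M i := by rw [hM, ← hd]; omega
      exact_mod_cast this
    have h4 : (4:ℝ)^(i^2) = Real.exp (2 * Real.log 2 * (√i)^4) := by
      have : (√(i:ℝ))^4 = ((i^2 : ℕ) : ℝ) := by
        rw [show (4:ℕ) = 2*2 by norm_num, pow_mul, Real.sq_sqrt (by positivity)]; push_cast; ring
      rw [this, mul_comm, Real.exp_nat_mul, mul_comm 2, Real.exp_mul, Real.exp_log (by norm_num)]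
      norm_num
    have htot := h9_total i hi
    calc Real.exp (Real.log 2 * (√i) ^ 4 - 4000 * (√i) ^ 3)
        ≤ Real.exp (2 * Real.log 2 * (√i)^4 - Real.log i +
          -∑ j ∈ Finset.Icc 1 (M (i + 1) + 1), Real.log (1 + 1 / (lam j * t j))) := by
          apply Real.exp_le_exp.2; linarith
      _ = (4:ℝ)^(i^2) / i *
          Real.exp (-∑ j ∈ Finset.Icc 1 (M (i + 1) + 1), Real.log (1 + 1 / (lam j * t j))) := by
          rw [Real.exp_add, Real.exp_sub, ← h4, Real.exp_log (by positivity)]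
      _ ≤ _ := by gcongr
end

section
/- For k ≥ 1 set d_k = 4^{k²} and α_k = 2^{2^{k³}}. Let i ≥ 1 and let k be an integer with 2 ≤ k ≤ i+1 such that 2^{k³} ≤ 2k² + k + i + 1. Let S_k have the Gamma distribution with shape d_k and rate α_k. Then P( S_k ≤ 2^{−k−i−1} ) ≥ e^{−d_k} · 2^{−i·d_k}. -/
open MeasureTheory ProbabilityTheory

lemma gamma_tail_aux (m : ℕ) (r t : ℝ) (hr : 0 < r) (ht : 0 < t) :
    ENNReal.ofReal (Real.exp (-(r * t)) * ((r * t) / ((m + 1 : ℕ) : ℝ)) ^ (m + 1))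
      ≤ gammaMeasure ((m + 1 : ℕ) : ℝ) r (Set.Iic t) := by
  rw [gammaMeasure, withDensity_apply _ measurableSet_Iic]
  set C : ℝ := r ^ (m + 1) / (m.factorial : ℝ) * Real.exp (-(r * t)) with hC
  have hC0 : 0 ≤ C := by positivity
  have h1 : ∫⁻ x in Set.Ioc 0 t, ENNReal.ofReal (C * x ^ m)
      ≤ ∫⁻ x in Set.Iic t, gammaPDF ((m + 1 : ℕ) : ℝ) r x := by
    refine le_trans ?_ (lintegral_mono_set (s := Set.Ioc 0 t) (fun x hx => hx.2))
    refine setLIntegral_mono' measurableSet_Ioc ?_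
    intro x hx
    rw [gammaPDF_of_nonneg hx.1.le]
    apply ENNReal.ofReal_le_ofReal
    have e1 : Real.Gamma ((m + 1 : ℕ) : ℝ) = m.factorial := by
      push_cast
      exact Real.Gamma_nat_eq_factorial m
    have e2 : (((m + 1 : ℕ) : ℝ) - 1) = (m : ℝ) := by push_cast; ring
    rw [e1, e2, Real.rpow_natCast, Real.rpow_natCast, hC]
    have e3 : Real.exp (-(r * t)) ≤ Real.exp (-(r * x)) := by
      apply Real.exp_le_exp.2
      have := mul_le_mul_of_nonneg_left hx.2 hr.le
      linarith
    have hx0 := hx.1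
    calc r ^ (m + 1) / (m.factorial : ℝ) * Real.exp (-(r * t)) * x ^ m
        = r ^ (m + 1) / (m.factorial : ℝ) * x ^ m * Real.exp (-(r * t)) := by ring
      _ ≤ _ := mul_le_mul_of_nonneg_left e3 (by positivity)
  refine le_trans ?_ h1
  rw [← ofReal_integral_eq_lintegral_ofReal]
  · apply ENNReal.ofReal_le_ofReal
    rw [← intervalIntegral.integral_of_le ht.le, intervalIntegral.integral_const_mul,
      integral_pow, hC]
    have hf : ((m + 1).factorial : ℝ) ≤ ((m + 1 : ℕ) : ℝ) ^ (m + 1) := by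
      exact_mod_cast Nat.factorial_le_pow (m + 1)
    have hfp : (0 : ℝ) < ((m + 1).factorial : ℝ) := by positivity
    have e : r ^ (m + 1) / (m.factorial : ℝ) * Real.exp (-(r * t)) *
        ((t ^ (m + 1) - 0 ^ (m + 1)) / ((m : ℝ) + 1))
        = Real.exp (-(r * t)) * ((r * t) ^ (m + 1) / ((m + 1).factorial : ℝ)) := by
      rw [Nat.factorial_succ]
      push_cast
      rw [mul_pow, zero_pow (Nat.succ_ne_zero m)]
      field_simp
      ring
    rw [e, div_pow]
    gcongr
  · have : Continuous fun x : ℝ => C * x ^ m := by fun_prop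
    exact (this.integrableOn_Icc (a := 0) (b := t)).mono_set Set.Ioc_subset_Icc_self
  · filter_upwards [ae_restrict_mem measurableSet_Ioc] with x hx
    have := hx.1
    simp only [Pi.zero_apply]
    positivity

/-- Inequality (eq. p3): with `d_k = 4^{k²}`, `α_k = 2^{2^{k³}}`, if `2 ≤ k ≤ i+1` and
`2^{k³} ≤ 2k² + k + i + 1`, and `S_k ~ Γ(d_k, α_k)`, then
`P(S_k ≤ 2^{−k−i−1}) ≥ e^{−d_k} · 2^{−i·d_k}`. -/
theorem stmt_13
    {Ω : Type*} [MeasurableSpace Ω] (P : Measure Ω) [IsProbabilityMeasure P]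
    (i k : ℕ) (hi : 1 ≤ i) (hk2 : 2 ≤ k) (hki : k ≤ i + 1)
    (hsmall : 2 ^ (k ^ 3) ≤ 2 * k ^ 2 + k + i + 1)
    (S : Ω → ℝ) (hS : Measurable S)
    (hdist : Measure.map S P = gammaMeasure (4 ^ (k ^ 2)) (2 ^ (2 ^ (k ^ 3)))) :
    ENNReal.ofReal
        (Real.exp (-(4 ^ (k ^ 2) : ℝ)) * 2 ^ (-((i * 4 ^ (k ^ 2) : ℕ) : ℝ)))
      ≤ P {ω | S ω ≤ 2 ^ (-(k : ℝ) - i - 1)} := by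
  have hP : P {ω | S ω ≤ 2 ^ (-(k : ℝ) - i - 1)}
      = gammaMeasure (4 ^ (k ^ 2)) (2 ^ (2 ^ (k ^ 3))) (Set.Iic (2 ^ (-(k : ℝ) - i - 1))) := by
    rw [← hdist, Measure.map_apply hS measurableSet_Iic]
    rfl
  rw [hP]
  obtain ⟨m, hm⟩ : ∃ m : ℕ, 4 ^ (k ^ 2) = m + 1 :=
    Nat.exists_eq_succ_of_ne_zero (by positivity)
  have hmR : (4 : ℝ) ^ (k ^ 2) = ((m + 1 : ℕ) : ℝ) := by rw [← hm]; push_cast; rfl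
  have hlow : 2 * k ^ 2 + k + 1 ≤ 2 ^ (k ^ 3) := by
    have a : k ^ 3 - 1 < 2 ^ (k ^ 3 - 1) := Nat.lt_two_pow_self
    have hk3 : 1 ≤ k ^ 3 := Nat.one_le_pow _ _ (by omega)
    have b : 2 ^ (k ^ 3) = 2 * 2 ^ (k ^ 3 - 1) := by
      rw [← pow_succ']; congr 1; omega
    have c : 2 * k ^ 2 ≤ k ^ 3 := by
      rw [pow_succ k 2]; nlinarith [sq_nonneg k]
    have d : 2 * k ≤ k ^ 2 := by nlinarith
    omega
  generalize hN : 2 ^ (k ^ 3) = N at *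
  have hd2 : (4 : ℝ) ^ (k ^ 2) = (2 : ℝ) ^ ((2 * k ^ 2 : ℕ) : ℝ) := by
    rw [Real.rpow_natCast, pow_mul]; norm_num
  have hy : (2 : ℝ) ^ N * 2 ^ (-(k : ℝ) - i - 1) = 2 ^ ((N : ℝ) + (-(k : ℝ) - i - 1)) := by
    rw [Real.rpow_add two_pos, Real.rpow_natCast]
  have hs' : (N : ℝ) ≤ 2 * (k : ℝ) ^ 2 + k + i + 1 := by exact_mod_cast hsmall
  have hl' : 2 * (k : ℝ) ^ 2 + k + 1 ≤ (N : ℝ) := by exact_mod_cast hlow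
  have hyd : (2 : ℝ) ^ N * 2 ^ (-(k : ℝ) - i - 1) ≤ (4 : ℝ) ^ (k ^ 2) := by
    rw [hy, hd2]
    apply Real.rpow_le_rpow_of_exponent_le one_le_two
    push_cast
    linarith
  have hyl : (2 : ℝ) ^ (-(i : ℝ)) ≤ (2 : ℝ) ^ N * 2 ^ (-(k : ℝ) - i - 1) / (4 : ℝ) ^ (k ^ 2) := by
    rw [hy, hd2, ← Real.rpow_sub two_pos]
    apply Real.rpow_le_rpow_of_exponent_le one_le_two
    push_cast
    linarith
  have key := gamma_tail_aux m (2 ^ N) (2 ^ (-(k : ℝ) - i - 1)) (by positivity) (by positivity)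
  rw [hm, hmR]
  rw [hmR] at hyd hyl
  refine le_trans (ENNReal.ofReal_le_ofReal ?_) key
  have e : (2 : ℝ) ^ (-((i * (m + 1) : ℕ) : ℝ)) = ((2 : ℝ) ^ (-(i : ℝ))) ^ (m + 1) := by
    rw [← Real.rpow_natCast, ← Real.rpow_mul two_pos.le]
    congr 1
    push_cast
    ring
  rw [e]
  gcongr
end

section
/- For k ≥ 1 set d_k = 4^{k²} and α_k = 2^{2^{k³}}, and for each i ≥ 1 and 1 ≤ k ≤ i+1 let S_k have the Gamma distribution with shape d_k and rate α_k. Then lim_{i→∞} (4/3)^{i²} · ∏_{k=1}^{i+1} P( S_k ≤ 2^{−k−i−1} ) = ∞. -/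
open MeasureTheory ProbabilityTheory Filter Finset

lemma lemA (n : ℕ) (hn : 2 ≤ n) (r y : ℝ) (hr : 0 < r) (hy : 0 < y) (h : r * y ≤ 1/2) :
    ENNReal.ofReal ((r*y/(2*n))^n) ≤ gammaMeasure n r (Set.Iic y) := by
  obtain ⟨m, rfl⟩ : ∃ m, n = m + 1 := ⟨n-1, by omega⟩
  have hm : 1 ≤ m := by omega
  unfold gammaMeasure
  rw [withDensity_apply _ measurableSet_Iic]
  have hn0 : (0:ℝ) < ((m+1 : ℕ):ℝ) := by positivity
  set c : ℝ := r^(m+1) / (m.factorial : ℝ) * (y/2)^m * (1/2) with hc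
  have hc0 : 0 ≤ c := by positivity
  calc ENNReal.ofReal ((r*y/(2*((m+1:ℕ):ℝ)))^(m+1)) 
      ≤ ENNReal.ofReal (c * (y/2)) := by
        apply ENNReal.ofReal_le_ofReal
        have h1 : (m.factorial : ℝ) * 2 ≤ ((m+1:ℕ):ℝ)^(m+1) := by
          have : m.factorial * 2 ≤ (m+1)^(m+1) := by
            rw [pow_succ]
            apply Nat.mul_le_mul _ (by omega)
            exact (Nat.factorial_le_pow m).trans (Nat.pow_le_pow_left (by omega) _)
          exact_mod_cast this
        have e1 : (r*y/(2*((m+1:ℕ):ℝ)))^(m+1) = (r*(y/2))^(m+1) / ((m+1:ℕ):ℝ)^(m+1) := by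
          rw [← div_pow]; congr 1; field_simp
        have e2 : c * (y/2) = (r*(y/2))^(m+1) / ((m.factorial : ℝ) * 2) := by
          rw [hc, mul_pow, pow_succ (y/2)]; field_simp
        rw [e1, e2]
        have : (0:ℝ) < m.factorial := by positivity
        gcongr
    _ = ∫⁻ x in Set.Icc (y/2) y, ENNReal.ofReal c := by
        rw [setLIntegral_const, Real.volume_Icc, ENNReal.ofReal_mul hc0]
        congr 2; ring
    _ ≤ ∫⁻ x in Set.Icc (y/2) y, gammaPDF ((m+1:ℕ):ℝ) r x := by
        apply setLIntegral_mono' measurableSet_Icc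
        intro x hx
        have hx0 : 0 < x := by linarith [hx.1]
        rw [gammaPDF_of_nonneg hx0.le]
        apply ENNReal.ofReal_le_ofReal
        have : Real.Gamma ((m+1:ℕ):ℝ) = m.factorial := by
          push_cast; exact Real.Gamma_nat_eq_factorial m
        rw [this, Real.rpow_natCast]
        have e3 : ((m+1:ℕ):ℝ) - 1 = (m:ℝ) := by push_cast; ring
        rw [e3, Real.rpow_natCast, hc]
        have hexp : 1/2 ≤ Real.exp (-(r*x)) := by
          have := Real.add_one_le_exp (-(r*x))
          have : r * x ≤ r * y := by gcongr; exact hx.2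
          linarith
        have := hx.1
        gcongr
    _ ≤ _ := lintegral_mono_set (fun x hx => hx.2)

lemma lemB (a r x : ℝ) (ha : 0 < a) (hr : 0 < r) (hx : 0 < x) :
    gammaMeasure a r (Set.Ioi x) ≤ ENNReal.ofReal (a/(r*x)) := by
  unfold gammaMeasure
  rw [withDensity_apply _ measurableSet_Ioi]
  calc _ ≤ ∫⁻ t in Set.Ioi x, ENNReal.ofReal (a/(r*x)) * gammaPDF (a+1) r t := by
        apply setLIntegral_mono' measurableSet_Ioi
        intro t ht
        have ht : x < t := ht
        have ht0 : 0 < t := hx.trans ht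
        rw [gammaPDF_of_nonneg ht0.le, gammaPDF_of_nonneg ht0.le, ← ENNReal.ofReal_mul (by positivity)]
        apply ENNReal.ofReal_le_ofReal
        rw [Real.Gamma_add_one ha.ne', Real.rpow_add_one hr.ne']
        have e : t ^ (a + 1 - 1) = t ^ (a-1) * t := by
          rw [← Real.rpow_add_one ht0.ne']; congr 1; ring
        have hG := Real.Gamma_pos_of_pos ha
        rw [e]
        have : a / (r * x) * (r ^ a * r / (a * Real.Gamma a) * (t ^ (a - 1) * t) * Real.exp (-(r * t))) = (r ^ a / Real.Gamma a * t ^ (a - 1) * Real.exp (-(r * t))) * (t/x) := by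
          field_simp
        rw [this]
        apply le_mul_of_one_le_right (by positivity)
        rw [one_le_div hx]; exact ht.le
    _ ≤ ∫⁻ t, ENNReal.ofReal (a/(r*x)) * gammaPDF (a+1) r t := setLIntegral_le_lintegral _ _
    _ = _ := by
        rw [lintegral_const_mul' _ _ ENNReal.ofReal_ne_top, lintegral_gammaPDF_eq_one (by linarith) hr, mul_one]

lemma lemC (k i : ℕ) (hk : 1 ≤ k) :
    (2:ℝ) ^ (-((4:ℝ)^(k^2) * (2*(k:ℝ)^2 + k + i + 2))) ≤
      (gammaMeasure (4 ^ (k ^ 2)) (2 ^ (2 ^ (k ^ 3))) (Set.Iic ((2:ℝ) ^ (-(k : ℝ) - i - 1)))).toReal := by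
  have hr : (0:ℝ) < 2 ^ (2 ^ (k ^ 3)) := by positivity
  have := isProbabilityMeasure_gammaMeasure (a := 4 ^ (k ^ 2)) (r := 2 ^ (2 ^ (k ^ 3))) (by positivity) hr
  have hr1 : (1:ℝ) ≤ 2 ^ (2 ^ (k ^ 3)) := one_le_pow₀ (by norm_num)
  set x : ℝ := (2:ℝ) ^ (-(k : ℝ) - i - 1) with hxd
  have hx : 0 < x := by positivity
  have hx2 : x ≤ 1/2 := by
    have : x ≤ (2:ℝ) ^ (-1:ℝ) := by
      apply Real.rpow_le_rpow_of_exponent_le (by norm_num)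
      have : (0:ℝ) ≤ k := by positivity
      have : (0:ℝ) ≤ i := by positivity
      linarith
    rw [Real.rpow_neg_one] at this; linarith
  have hm : (2 ^ (2 ^ (k ^ 3)) : ℝ) * (x / 2 ^ (2 ^ (k ^ 3))) = x := by field_simp
  have h4 : 2 ≤ 4 ^ (k^2) := by
    calc 2 ≤ 4 ^ 1 := by norm_num
      _ ≤ _ := Nat.pow_le_pow_right (by norm_num) (Nat.one_le_pow _ _ hk)
  have h := lemA (4^(k^2)) h4 (2 ^ (2 ^ (k ^ 3))) (x / 2 ^ (2 ^ (k ^ 3))) hr (by positivity) (by rw [hm]; exact hx2)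
  rw [hm] at h
  push_cast at h
  have h' := h.trans (measure_mono (Set.Iic_subset_Iic.mpr (div_le_self hx.le hr1)))
  have h'' := (ENNReal.ofReal_le_iff_le_toReal (measure_ne_top _ _)).mp h'
  refine le_trans (le_of_eq ?_) h''
  have e : x / (2 * 4^(k^2)) = (2:ℝ) ^ (-(2*(k:ℝ)^2 + k + i + 2)) := by
    have : (2 * 4^(k^2) : ℝ) = (2:ℝ) ^ (2*(k:ℝ)^2+1) := by
      rw [Real.rpow_add_one (by norm_num), Real.rpow_mul (by norm_num)]
      norm_num
      rw [mul_comm]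
      congr 1
      exact_mod_cast rfl
    rw [this, hxd, ← Real.rpow_sub (by norm_num)]
    congr 1; ring
  rw [e, ← Real.rpow_natCast _ (4^(k^2)), ← Real.rpow_mul (by norm_num)]
  push_cast
  congr 1; ring

lemma lemD (k i : ℕ) (h : 2*k^2 + k + i + 2 ≤ 2^(k^3)) :
    (2:ℝ) ^ (-1:ℝ) ≤
      (gammaMeasure (4 ^ (k ^ 2)) (2 ^ (2 ^ (k ^ 3))) (Set.Iic ((2:ℝ) ^ (-(k : ℝ) - i - 1)))).toReal := by
  have hr : (0:ℝ) < 2 ^ (2 ^ (k ^ 3)) := by positivity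
  have := isProbabilityMeasure_gammaMeasure (a := 4 ^ (k ^ 2)) (r := 2 ^ (2 ^ (k ^ 3))) (by positivity) hr
  set x : ℝ := (2:ℝ) ^ (-(k : ℝ) - i - 1) with hxd
  have hx : 0 < x := by positivity
  have hB := lemB (4 ^ (k ^ 2)) (2 ^ (2 ^ (k ^ 3))) x (by positivity) hr hx
  have hle : (4 ^ (k ^ 2) : ℝ) / (2 ^ (2 ^ (k ^ 3)) * x) ≤ 1/2 := by
    rw [div_le_iff₀ (by positivity)]
    have e4 : (4 ^ (k ^ 2) : ℝ) = (2:ℝ) ^ (2*(k:ℝ)^2) := by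
      rw [Real.rpow_mul (by norm_num)]
      norm_num
      exact_mod_cast rfl
    have eh : (1/2 : ℝ) = (2:ℝ) ^ (-1:ℝ) := by rw [Real.rpow_neg_one]; norm_num
    rw [e4, hxd, eh, ← Real.rpow_natCast 2 (2^(k^3)), ← Real.rpow_add (by norm_num), ← Real.rpow_add (by norm_num)]
    apply Real.rpow_le_rpow_of_exponent_le (by norm_num)
    have : (((2*k^2 + k + i + 2 : ℕ)) : ℝ) ≤ ((2^(k^3) : ℕ) : ℝ) := by exact_mod_cast h
    push_cast at this ⊢
    linarith
  have hB' : (gammaMeasure (4 ^ (k ^ 2)) (2 ^ (2 ^ (k ^ 3)))).real (Set.Ioi x) ≤ 1/2 := by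
    apply ENNReal.toReal_le_of_le_ofReal (by norm_num)
    exact hB.trans (ENNReal.ofReal_le_ofReal hle)
  have hc := probReal_compl_eq_one_sub (μ := gammaMeasure (4 ^ (k ^ 2)) (2 ^ (2 ^ (k ^ 3)))) (s := Set.Iic x) measurableSet_Iic
  rw [Set.compl_Iic] at hc
  rw [Real.rpow_neg_one]
  change _ ≤ (gammaMeasure (4 ^ (k ^ 2)) (2 ^ (2 ^ (k ^ 3)))).real (Set.Iic x)
  linarith

lemma small_bound (k : ℕ) (hk : 1 ≤ k) : 2 * (2*k^2 + k) ≤ 2^(k^3) + 4 := by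
  rcases Nat.lt_or_ge k 3 with h | h
  · interval_cases k <;> norm_num
  · have h1 : 9 * k ≤ k^3 := by nlinarith [Nat.pow_le_pow_left h 2]
    have h2 : 2^(9*k) ≤ 2^(k^3) := Nat.pow_le_pow_right (by norm_num) h1
    have h3 : k < 2^k := Nat.lt_two_pow_self
    have h4 : 2^(9*k) = (2^k)^2 * (2^k)^7 := by ring
    have h5 : 8 ≤ (2^k)^7 := by
      calc 8 = 2^3 := by norm_num
        _ ≤ 2^(k*7) := Nat.pow_le_pow_right (by norm_num) (by omega)
        _ = _ := by ring
    have : (2^k)^2 * 8 ≤ (2^k)^2 * (2^k)^7 := Nat.mul_le_mul_left _ h5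
    nlinarith

noncomputable def lossF (i k : ℕ) : ℝ :=
  if 2*k^2 + k + i + 2 ≤ 2^(k^3) then 1 else (4:ℝ)^(k^2) * (2*(k:ℝ)^2 + k + i + 2)

lemma lemE (i : ℕ) : ∑ k ∈ Finset.Icc 1 (i+1), lossF i k ≤
    (i + 1) + ((2*((i:ℝ)+4))^2/100 + 25 * 2^512 * (2*((i:ℝ)+4))) := by
  set M : ℝ := 2*((i:ℝ)+4) with hM
  have hM0 : 0 < M := by positivity
  set D : ℝ := 2^128 * Real.sqrt (Real.sqrt M) with hD
  have hD0 : 0 ≤ D := by positivity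
  have hD2 : D^2 = 2^256 * Real.sqrt M := by
    rw [hD, mul_pow, Real.sq_sqrt (by positivity)]; ring
  have hD4 : D^4 = 2^512 * M := by
    have : D^4 = (D^2)^2 := by ring
    rw [this, hD2, mul_pow, Real.sq_sqrt hM0.le, ← pow_mul]
  set s := (Finset.Icc 1 (i+1)).filter (fun k => ¬ (2*k^2 + k + i + 2 ≤ 2^(k^3))) with hs
  have key : ∀ k ∈ s, (4:ℝ)^(k^2) ≤ D ∧ (2*(k:ℝ)^2 + k + i + 2) ≤ M := by
    intro k hk
    rw [hs, Finset.mem_filter, Finset.mem_Icc] at hk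
    obtain ⟨⟨hk1, _⟩, hk2⟩ := hk
    have hb := small_bound k hk1
    have hA : 2^(k^3) ≤ 2*(i+4) := by omega
    have hB : 2*k^2+k+i+2 ≤ 2*(i+4) := by omega
    constructor
    · apply le_of_pow_le_pow_left₀ (n := 4) (by norm_num) hD0
      rw [hD4]
      have h1 : 8 * k^2 ≤ 512 + k^3 := by
        rcases Nat.lt_or_ge k 8 with h | h
        · nlinarith
        · nlinarith [Nat.mul_le_mul_right (k^2) h]
      have h2 : ((4:ℝ)^(k^2))^4 = 2^(8*k^2) := by
        rw [show (4:ℝ) = 2^2 by norm_num, ← pow_mul, ← pow_mul]; congr 1; ring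
      rw [h2]
      have hA' : ((2:ℝ)^(k^3)) ≤ M := by rw [hM]; exact_mod_cast hA
      calc (2:ℝ)^(8*k^2) ≤ 2^(512 + k^3) := pow_le_pow_right₀ (by norm_num) h1
        _ = 2^512 * 2^(k^3) := pow_add _ _ _
        _ ≤ _ := by gcongr
    · rw [hM]; exact_mod_cast hB
  have hcard : (s.card : ℝ) ≤ D := by
    have : s ⊆ Finset.Icc 1 ⌊D⌋₊ := by
      intro k hk
      have h := (key k hk).1
      rw [hs, Finset.mem_filter, Finset.mem_Icc] at hk
      rw [Finset.mem_Icc]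
      refine ⟨hk.1.1, Nat.le_floor (le_trans ?_ h)⟩
      have : k ≤ 4^(k^2) := 
        calc k ≤ k^2 := Nat.le_self_pow (by norm_num) k
          _ ≤ 4^(k^2) := (Nat.lt_pow_self (by norm_num)).le
      exact_mod_cast this
    have h := Finset.card_le_card this
    rw [Nat.card_Icc, Nat.add_sub_cancel] at h
    exact (Nat.cast_le.mpr h).trans (Nat.floor_le hD0)
  unfold lossF
  rw [Finset.sum_ite]
  apply add_le_add
  · rw [Finset.sum_const, nsmul_eq_mul, mul_one]
    have := Finset.card_filter_le (Finset.Icc 1 (i+1)) (fun k => 2*k^2 + k + i + 2 ≤ 2^(k^3))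
    rw [Nat.card_Icc, Nat.add_sub_cancel] at this
    exact_mod_cast this
  · calc _ ≤ s.card • (D * M) := by
          apply Finset.sum_le_card_nsmul
          intro k hk
          have := key k hk
          gcongr
          exacts [this.1, this.2]
      _ = s.card * (D * M) := nsmul_eq_mul _ _
      _ ≤ D * (D * M) := by gcongr
      _ = D^2 * M := by ring
      _ ≤ (M/100 + 25 * 2^512) * M := by
          gcongr
          rw [hD2]
          have := Real.sq_sqrt hM0.le
          have e512 : (2:ℝ)^512 = (2^256)^2 := by rw [← pow_mul]
          rw [e512]
          generalize (2:ℝ)^256 = b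
          nlinarith [sq_nonneg (Real.sqrt M / 10 - 5 * b)]
      _ = _ := by ring

theorem stmt_15
    {Ω : Type*} [MeasurableSpace Ω] (P : Measure Ω) [IsProbabilityMeasure P]
    (S : ℕ → Ω → ℝ) (hmeas : ∀ k, Measurable (S k))
    (hdist : ∀ k ≥ 1,
      Measure.map (S k) P = gammaMeasure (4 ^ (k ^ 2)) (2 ^ (2 ^ (k ^ 3)))) :
    Tendsto
      (fun i : ℕ =>
        (4 / 3 : ℝ) ^ (i ^ 2) *
          ∏ k ∈ Finset.Icc 1 (i + 1),
            (P {ω | S k ω ≤ 2 ^ (-(k : ℝ) - i - 1)}).toReal)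
      atTop atTop := by
  obtain ⟨C, hC⟩ : ∃ C : ℝ, C = 25 * 2^512 := ⟨_, rfl⟩
  have hCp : 0 < C := by rw [hC]; positivity
  have hlow : ∀ i : ℕ, (2:ℝ) ^ ((2/5:ℝ)*(i:ℝ)^2 - ((i + 1) + ((2*((i:ℝ)+4))^2/100 + C * (2*((i:ℝ)+4))))) ≤
      (4 / 3 : ℝ) ^ (i ^ 2) *
          ∏ k ∈ Finset.Icc 1 (i + 1),
            (P {ω | S k ω ≤ 2 ^ (-(k : ℝ) - i - 1)}).toReal := by
    intro i
    have hE := lemE i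
    rw [← hC] at hE
    have h43 : (2:ℝ)^((2/5:ℝ)*(i:ℝ)^2) ≤ (4/3:ℝ)^(i^2) := by
      rw [Real.rpow_mul (by norm_num)]
      have : ((2:ℝ)^(2/5:ℝ)) ≤ 4/3 := by
        apply le_of_pow_le_pow_left₀ (n := 5) (by norm_num) (by norm_num)
        rw [← Real.rpow_natCast, ← Real.rpow_mul (by norm_num)]
        norm_num
      rw [show ((i:ℝ)^2) = ((i^2 : ℕ) : ℝ) by push_cast; rfl, Real.rpow_natCast]
      gcongr
    calc _ ≤ (2:ℝ) ^ ((2/5:ℝ)*(i:ℝ)^2 + ∑ k ∈ Finset.Icc 1 (i+1), (- lossF i k)) := by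
          apply Real.rpow_le_rpow_of_exponent_le (by norm_num)
          rw [Finset.sum_neg_distrib]; linarith
      _ = (2:ℝ)^((2/5:ℝ)*(i:ℝ)^2) * ∏ k ∈ Finset.Icc 1 (i+1), (2:ℝ)^(-lossF i k) := by
          rw [Real.rpow_add (by norm_num), Real.rpow_sum_of_pos (by norm_num)]
      _ ≤ _ := by
          gcongr with k hk
          rw [Finset.mem_Icc] at hk
          have e : P {ω | S k ω ≤ 2 ^ (-(k : ℝ) - i - 1)} = gammaMeasure (4 ^ (k ^ 2)) (2 ^ (2 ^ (k ^ 3))) (Set.Iic ((2:ℝ) ^ (-(k : ℝ) - i - 1))) := by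
            rw [← hdist k hk.1, Measure.map_apply (hmeas k) measurableSet_Iic]; rfl
          rw [e]
          unfold lossF
          split_ifs with h
          · exact lemD k i h
          · exact lemC k i hk.1
  apply tendsto_atTop_mono hlow
  have hexp : Tendsto (fun x : ℝ => (2:ℝ)^x) atTop atTop :=
    tendsto_rpow_atTop_of_base_gt_one _ (by norm_num)
  apply hexp.comp
  have hlin : Tendsto (fun i : ℕ => (i:ℝ)) atTop atTop := tendsto_natCast_atTop_atTop
  apply tendsto_atTop_mono' _ _ hlin
  filter_upwards [hlin.eventually_ge_atTop (100 + 100 * C)] with i hi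
  clear hlow hC
  have h1 := mul_le_mul_of_nonneg_right hi (by positivity : (0:ℝ) ≤ i)
  have h2 : C * 1 ≤ C * i := mul_le_mul_of_nonneg_left (by linarith) hCp.le
  nlinarith
end
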